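/- Let R be a smooth (regular, finite type) commutative ℂ-algebra and M a finitely generated R-module equipped with a connection ∇ : Der_ℂ(R) × M → M satisfying the Leibniz rule ∇_ξ(f m) = ξ(f) m + f ∇_ξ(m). Then M is a projective R-module (i.e., a vector bundle on Spec R). -/

import Mathlib

/-- Given a maximal ideal `m` of a smooth `ℂ`-algebra, there is an Euler-type derivation
`∑ i, x i • ξ i` with all `x i ∈ m` acting as the identity on `m / m ^ 2`. -/
lemma exists_euler_derivation (R : Type) [CommRing R] [Algebra ℂ R] [Algebra.Smooth ℂ R]
    (m : Ideal R) [m.IsMaximal] :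
    ∃ (n : ℕ) (x : Fin n → R) (ξ : Fin n → Derivation ℂ R R), (∀ i, x i ∈ m) ∧
      ∀ y ∈ m, (∑ i, x i * ξ i y) - y ∈ m ^ 2 := by
  have : IsNoetherianRing R := Algebra.FiniteType.isNoetherianRing ℂ R
  let : Field (R ⧸ m) := Ideal.Quotient.field m
  have : Module.Finite ℂ (R ⧸ m) := finite_of_finite_type_of_isJacobsonRing ℂ (R ⧸ m)
  let e : ℂ ≃ₐ[ℂ] (R ⧸ m) := AlgEquiv.ofBijective (Algebra.ofId ℂ (R ⧸ m))
    IsAlgClosed.algebraMap_bijective_of_isIntegral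
  let π : R →ₐ[ℂ] ℂ := e.symm.toAlgHom.comp (Ideal.Quotient.mkₐ ℂ m)
  have hπ (y : R) : π y = 0 ↔ y ∈ m := by
    change e.symm (Ideal.Quotient.mk m y) = 0 ↔ _
    rw [EmbeddingLike.map_eq_zero_iff, Ideal.Quotient.eq_zero_iff_mem]
  let P : R →ₗ[ℂ] m :=
    { toFun := fun y => ⟨y - algebraMap ℂ R (π y), by rw [← hπ]; simp⟩
      map_add' := fun a b => by ext; simp; ring
      map_smul' := fun c a => by ext; simp [Algebra.smul_def]; ring }
  let D : Derivation ℂ R m.Cotangent :=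
    Derivation.mk' ((m.toCotangent.restrictScalars ℂ).comp P) (fun a b => by
      change m.toCotangent (P (a * b)) = a • m.toCotangent (P b) +
        b • m.toCotangent (P a)
      rw [← m.toCotangent.map_smul, ← m.toCotangent.map_smul, ← map_add, Ideal.toCotangent_eq]
      have h : ((P (a * b) : m) : R) - ((a • P b + b • P a : m) : R) =
          -((P a : R) * (P b : R)) := by
        simp only [P, LinearMap.coe_mk, AddHom.coe_mk, map_mul, Submodule.coe_add,
          Submodule.coe_smul, smul_eq_mul]
        ring
      rw [h, pow_two]
      exact neg_mem (Ideal.mul_mem_mul (P a).2 (P b).2))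
  obtain ⟨n, g, hg⟩ := Module.Finite.exists_fin' R m
  obtain ⟨φ, hφ⟩ := Module.projective_lifting_property (m.toCotangent ∘ₗ g)
    D.liftKaehlerDifferential (m.toCotangent_surjective.comp hg)
  refine ⟨n, fun i => g (Pi.single i 1),
    fun i => ((LinearMap.proj i).comp φ).compDer (KaehlerDifferential.D ℂ R),
    fun i => (g _).2, fun y hy => ?_⟩
  have h1 := LinearMap.congr_fun hφ (KaehlerDifferential.D ℂ R y)
  rw [Derivation.liftKaehlerDifferential_comp_D] at h1
  have h2 : D y = m.toCotangent ⟨y, hy⟩ := by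
    change m.toCotangent (P y) = _
    congr 1
    ext
    simp [P, (hπ y).2 hy]
  rw [h2, LinearMap.comp_apply, LinearMap.comp_apply, Ideal.toCotangent_eq] at h1
  convert h1 using 2
  set v := φ (KaehlerDifferential.D ℂ R y) with hv
  conv_rhs => rw [LinearMap.pi_apply_eq_sum_univ g v]
  rw [AddSubmonoidClass.coe_finsetSum]
  refine Finset.sum_congr rfl fun i _ => ?_
  rw [Submodule.coe_smul, smul_eq_mul, mul_comm]
  congr 1
  change (g _ : R) = g _
  congr 2
  ext j
  simp [Pi.single_apply, eq_comm]

/-- A derivation acting as the identity on `m / m ^ 2` acts as `k` on `m ^ k / m ^ (k + 1)`. -/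
lemma Derivation.sub_natCast_mul_mem_pow_succ {A R : Type*} [CommRing A] [CommRing R]
    [Algebra A R] {m : Ideal R} (E : Derivation A R R) (hE : ∀ y ∈ m, E y - y ∈ m ^ 2)
    (hE' : ∀ y, E y ∈ m) (k : ℕ) {f : R} (hf : f ∈ m ^ k) : E f - k * f ∈ m ^ (k + 1) := by
  induction k generalizing f with
  | zero => simpa using hE' f
  | succ k ih =>
    rw [pow_succ'] at hf
    refine Submodule.mul_induction_on hf (fun a ha b hb => ?_) (fun a b ha hb => ?_)
    · have h : E (a * b) - ((k + 1 : ℕ) : R) * (a * b) =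
          a * (E b - k * b) + (E a - a) * b := by
        rw [E.leibniz]; push_cast; simp only [smul_eq_mul]; ring
      rw [h]
      refine add_mem ?_ ?_
      · rw [pow_succ' m (k + 1)]
        exact Ideal.mul_mem_mul ha (ih hb)
      · rw [show k + 1 + 1 = 2 + k by ring, pow_add]
        exact Ideal.mul_mem_mul (hE a ha) hb
    · rw [map_add, mul_add, add_sub_add_comm]
      exact add_mem ha hb

/-- On a smooth `ℂ`-algebra, if all first derivatives of `f ∈ m ^ k` vanish to order `k`,
then `f` vanishes to order `k + 1`. -/
lemma mem_pow_succ_of_derivation_mem {R : Type} [CommRing R] [Algebra ℂ R] [Algebra.Smooth ℂ R]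
    (m : Ideal R) [m.IsMaximal] {k : ℕ} (hk : k ≠ 0) {f : R} (hf : f ∈ m ^ k)
    (h : ∀ ξ : Derivation ℂ R R, ξ f ∈ m ^ k) : f ∈ m ^ (k + 1) := by
  obtain ⟨n, x, ξ, hx, hxξ⟩ := exists_euler_derivation R m
  let E : Derivation ℂ R R := ∑ i, x i • ξ i
  have hE (y : R) : E y = ∑ i, x i * ξ i y := by
    exact (congrFun (map_sum Derivation.coeFnAddMonoidHom (fun i => x i • ξ i) Finset.univ) y).trans
      (Finset.sum_apply _ _ _)
  have h1 : E f - k * f ∈ m ^ (k + 1) := by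
    refine E.sub_natCast_mul_mem_pow_succ (fun y hy => ?_) (fun y => ?_) k hf
    · rw [hE]; exact hxξ y hy
    · rw [hE]; exact sum_mem fun i _ => Ideal.mul_mem_right _ _ (hx i)
  have h2 : E f ∈ m ^ (k + 1) := by
    rw [hE, pow_succ']
    exact sum_mem fun i _ => Ideal.mul_mem_mul (hx i) (h _)
  have h3 : (k : R) * f ∈ m ^ (k + 1) := by simpa using sub_mem h2 h1
  have h4 : f = algebraMap ℂ R (k : ℂ)⁻¹ * (k * f) := by
    rw [← mul_assoc, ← map_natCast (algebraMap ℂ R) k, ← map_mul,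
      inv_mul_cancel₀ (Nat.cast_ne_zero.2 hk), map_one, one_mul]
  rw [h4]
  exact Ideal.mul_mem_left _ _ h3

/-- A finite module over a commutative ring has, at every maximal ideal `m`, finitely many elements
that form a basis modulo `m` and generate the module after inverting some `s ∉ m`. -/
lemma exists_lift_basis_residue {R M : Type*} [CommRing R] [AddCommGroup M] [Module R M]
    [Module.Finite R M] (m : Ideal R) [m.IsMaximal] :
    ∃ (n : ℕ) (e : Fin n → M),
      (∀ f : Fin n → R, ∑ i, f i • e i = 0 → ∀ i, f i ∈ m) ∧
      ∃ s ∉ m, ∀ x : M, ∃ f : Fin n → R, s • x = ∑ i, f i • e i := by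
  let : Field (R ⧸ m) := Ideal.Quotient.field m
  let N : Submodule R M := m • ⊤
  let b := Module.finBasis (R ⧸ m) (M ⧸ N)
  choose e he using fun i => N.mkQ_surjective (b i)
  have hmk (f : Fin _ → R) : N.mkQ (∑ i, f i • e i) = ∑ i, Ideal.Quotient.mk m (f i) • b i := by
    simp only [map_sum, map_smul, he]
    rfl
  refine ⟨_, e, fun f hf i => ?_, ?_⟩
  · have h := hmk f
    rw [hf, map_zero] at h
    exact Ideal.Quotient.eq_zero_iff_mem.1
      (Fintype.linearIndependent_iff.1 b.linearIndependent _ h.symm i)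
  · obtain ⟨s, hs, hsN⟩ := Submodule.exists_sub_one_mem_and_smul_le_of_fg_of_le_sup
      (I := m) (N := Submodule.span R (Set.range e)) (N' := ⊤) (P := ⊤)
      Module.Finite.fg_top le_rfl (fun x _ => by
        choose f hf using fun i => Ideal.Quotient.mk_surjective (b.repr (N.mkQ x) i)
        have h : N.mkQ (x - ∑ i, f i • e i) = 0 := by
          rw [map_sub, hmk, sub_eq_zero]
          simp only [hf]
          exact (b.sum_repr _).symm
        rw [Submodule.mkQ_apply, Submodule.Quotient.mk_eq_zero] at h
        rw [← add_sub_cancel (∑ i, f i • e i) x]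
        refine Submodule.add_mem_sup (sum_mem fun i _ => ?_) h
        exact Submodule.smul_mem _ _ (Submodule.subset_span ⟨i, rfl⟩))
    refine ⟨s, fun hsm => ?_, fun x => ?_⟩
    · exact (Ideal.ne_top_iff_one m).1 (Ideal.IsMaximal.ne_top ‹_›)
        (by simpa using sub_mem hsm hs)
    · have := hsN (Submodule.smul_mem_pointwise_smul x s ⊤ trivial)
      obtain ⟨f, hf⟩ := (Submodule.mem_span_range_iff_exists_fun R).1 this
      exact ⟨f, hf.symm⟩

/-- A linear map whose kernel and cokernel are killed by elements of `S` becomes bijective after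
localizing at `S`. -/
lemma LocalizedModule.map_bijective {R N M : Type*} [CommRing R] [AddCommGroup N] [Module R N]
    [AddCommGroup M] [Module R M] (S : Submonoid R) (f : N →ₗ[R] M)
    (hker : ∀ x, f x = 0 → ∃ t ∈ S, t • x = 0)
    (hcoker : ∀ y, ∃ s ∈ S, ∃ x, f x = s • y) :
    Function.Bijective (LocalizedModule.map S f) := by
  constructor
  · rw [← LinearMap.coe_restrictScalars R, injective_iff_map_eq_zero]
    intro z hz
    induction z using LocalizedModule.induction_on with
    | _ x s =>
      rw [LinearMap.coe_restrictScalars, LocalizedModule.map_mk, IsLocalizedModule.mk_eq_mk',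
        IsLocalizedModule.mk'_eq_zero'] at hz
      obtain ⟨u, h⟩ := hz
      rw [Submonoid.smul_def, ← map_smul] at h
      obtain ⟨t, ht, h⟩ := hker _ h
      rw [IsLocalizedModule.mk_eq_mk', IsLocalizedModule.mk'_eq_zero']
      exact ⟨⟨t, ht⟩ * u, by rw [mul_smul]; exact h⟩
  · intro z
    induction z using LocalizedModule.induction_on with
    | _ y s =>
      obtain ⟨u, hu, x, hx⟩ := hcoker y
      refine ⟨LocalizedModule.mk x (⟨u, hu⟩ * s), ?_⟩
      rw [LocalizedModule.map_mk, hx]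
      exact LocalizedModule.mk_cancel_common_left ⟨u, hu⟩ s y

/-- a finitely generated module with a connection over a smooth
(regular, finite type) commutative ℂ-algebra is projective (a vector bundle). -/
theorem projective_of_connection
    (R : Type) [CommRing R] [Algebra ℂ R] [Algebra.Smooth ℂ R]
    (M : Type) [AddCommGroup M] [Module R M] [Module.Finite R M]
    (Dd : Derivation ℂ R R → M → M)
    (hadd : ∀ ξ (m m' : M), Dd ξ (m + m') = Dd ξ m + Dd ξ m')
    (haddξ : ∀ (ξ ξ' : Derivation ℂ R R) (m : M), Dd (ξ + ξ') m = Dd ξ m + Dd ξ' m)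
    (hlin : ∀ (f : R) (ξ : Derivation ℂ R R) (m : M), Dd (f • ξ) m = f • Dd ξ m)
    (hLeibniz : ∀ (ξ : Derivation ℂ R R) (f : R) (m : M),
      Dd ξ (f • m) = ξ f • m + f • Dd ξ m) :
    Module.Projective R M := by
  have : IsNoetherianRing R := Algebra.FiniteType.isNoetherianRing ℂ R
  have : Module.FinitePresentation R M := Module.finitePresentation_of_finite R M
  refine Module.projective_of_localization_maximal fun m hm => ?_
  obtain ⟨n, e, hrel, s, hs, hgen⟩ := exists_lift_basis_residue (M := M) m
  have hpow (k : ℕ) (hk : k ≠ 0) :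
      ∀ f : Fin n → R, ∑ i, f i • e i = 0 → ∀ i, f i ∈ m ^ k := by
    induction k, Nat.one_le_iff_ne_zero.2 hk using Nat.le_induction with
    | base => simpa using hrel
    | succ k hk1 ih =>
      have hk0 := Nat.one_le_iff_ne_zero.1 hk1
      intro f hf j
      refine mem_pow_succ_of_derivation_mem m hk0 (ih hk0 f hf j) fun ξ => ?_
      choose a ha using fun i => hgen (Dd ξ (e i))
      let D : M →+ M := AddMonoidHom.mk' (Dd ξ) (hadd ξ)
      have h0 : ∑ i, (ξ (f i) • e i + f i • Dd ξ (e i)) = 0 := by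
        have h := congrArg D hf
        rw [map_sum, map_zero] at h
        rw [← h]
        exact Finset.sum_congr rfl fun i _ => (hLeibniz ξ (f i) (e i)).symm
      have h1 : ∑ j, (s * ξ (f j) + ∑ i, f i * a i j) • e j = 0 := by
        rw [← smul_zero s, ← h0, Finset.smul_sum]
        simp only [add_smul, smul_add, Finset.sum_add_distrib, mul_smul, Finset.sum_smul]
        congr 1
        rw [Finset.sum_comm]
        refine Finset.sum_congr rfl fun i _ => ?_
        rw [smul_comm, ha, Finset.smul_sum]
      have h2 := ih hk0 _ h1 j
      have h3 : ∑ i, f i * a i j ∈ m ^ k :=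
        sum_mem fun i _ => Ideal.mul_mem_right _ _ (ih hk0 f hf i)
      exact (Ideal.IsMaximal.mul_mem_pow m ((add_mem_cancel_right h3).1 h2)).resolve_left hs
  let F : (Fin n → R) →ₗ[R] M := Fintype.linearCombination R e
  have hF (f : Fin n → R) : F f = ∑ i, f i • e i := Fintype.linearCombination_apply R e f
  have hbij : Function.Bijective (LocalizedModule.map m.primeCompl F) := by
    refine LocalizedModule.map_bijective _ F (fun f hf => ?_) (fun y => ?_)
    · rw [hF] at hf
      have hinf (i) : ∃ r : m, (r : R) • f i = f i := by
        refine (Ideal.mem_iInf_smul_pow_eq_bot_iff m (f i)).1 ((Submodule.mem_iInf _).2 fun k => ?_)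
        rcases eq_or_ne k 0 with rfl | hk
        · simp
        · simpa using hpow k hk f hf i
      choose r hr using hinf
      refine ⟨∏ i, (1 - (r i : R)), prod_mem fun i _ h => ?_, ?_⟩
      · exact (Ideal.ne_top_iff_one m).1 hm.ne_top (by simpa using add_mem h (r i).2)
      · ext i
        have hi : (1 - (r i : R)) * f i = 0 := by
          rw [sub_mul, one_mul, ← smul_eq_mul (r i : R), hr, sub_self]
        rw [Pi.smul_apply, smul_eq_mul, ← Finset.prod_erase_mul _ _ (Finset.mem_univ i),
          mul_assoc, hi, mul_zero, Pi.zero_apply]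
    · obtain ⟨f, hf⟩ := hgen y
      exact ⟨s, hs, f, by rw [hF, hf]⟩
  exact Module.Projective.of_equiv (LinearEquiv.ofBijective _ hbij)
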